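/- Fix ρ > 0, integers M ≥ N ≥ 1, and positive reals c_0, …, c_{N−1}. For every nonzero A ∈ 𝒫_N(D̄(0,ρ)) and every vector v ∈ ℂ^N orthogonal to 𝒦(A) := ker(c_0·1_{N×N} + c_1 A + ⋯ + c_{N−1} A^{∘(N−1)}) with v* A^{∘M} v ≠ 0, one has v*(Σ_{j=0}^{N−1} c_j A^{∘j})v / (v* A^{∘M} v) ≥ 𝒞(c; z^M; N, ρ)^{−1}. Moreover this lower bound is sharp, and the sharpness is already attained over the set of rank-one matrices 𝒫_N^1((0,ρ)): the infimum of these quotients over all nonzero A ∈ 𝒫_N^1((0,ρ)) and admissible v equals 𝒞(c; z^M; N, ρ)^{−1}. -/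

import Mathlib

open scoped ComplexOrder Matrix

noncomputable section

/-- The `k`-th Hadamard (entrywise) power of a matrix. -/
def hadPow {N : ℕ} (A : Matrix (Fin N) (Fin N) ℂ) (k : ℕ) : Matrix (Fin N) (Fin N) ℂ :=
  Matrix.of fun i j => A i j ^ k

/-- The constant `𝒞(c; z^M; N, ρ)`. -/
def CC (N : ℕ) (c : Fin N → ℝ) (M : ℕ) (ρ : ℝ) : ℝ :=
  ∑ j : Fin N, (M.choose j : ℝ) ^ 2 * ((M - (j : ℕ) - 1).choose (N - (j : ℕ) - 1) : ℝ) ^ 2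
    * ρ ^ (M - (j : ℕ)) / c j

/-- Up to sign, `hook x (N + 1) k j` is the coefficient of `z ^ j` in the remainder of `z ^ (N + k)`
modulo `∏ i ≤ N, (z - x i)`; it is the hook Schur polynomial `s_(k, 1 ^ (N - j))`
in the variables `x 0, …, x N`. -/
def hook {R : Type*} [CommSemiring R] (x : ℕ → R) : ℕ → ℕ → ℕ → R
  | 0, _, _ => 0
  | N + 1, 0, j => if j = N then 1 else 0
  | N + 1, k + 1, 0 => x N * hook x (N + 1) k 0 + x N * hook x N (k + 1) 0
  | N + 1, k + 1, j + 1 =>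
      x N * hook x (N + 1) k (j + 1) + hook x N (k + 1) j + x N * hook x N (k + 1) (j + 1)

lemma hook_eq_zero {R : Type*} [CommSemiring R] (x : ℕ → R) (N k j : ℕ) (h : N ≤ j) :
    hook x N k j = 0 := by
  induction N generalizing k j with
  | zero => simp [hook]
  | succ N ihN =>
    obtain ⟨j, rfl⟩ : ∃ i, j = i + 1 := ⟨j - 1, by omega⟩
    induction k with
    | zero => simp [hook]; omega
    | succ k ihk => simp [hook, ihk, ihN (k + 1) j (by omega), ihN (k + 1) (j + 1) (by omega)]

lemma hook_nonneg {x : ℕ → ℝ} (hx : ∀ i, 0 ≤ x i) (N k j : ℕ) : 0 ≤ hook x N k j := by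
  induction N generalizing k j with
  | zero => simp [hook]
  | succ N ihN =>
    induction k generalizing j with
    | zero => simp only [hook]; split_ifs <;> norm_num
    | succ k ihk =>
      have := hx N
      cases j with
      | zero => have := ihk 0; have := ihN (k + 1) 0; simp only [hook]; positivity
      | succ j =>
        have := ihk (j + 1); have := ihN (k + 1) j; have := ihN (k + 1) (j + 1)
        simp only [hook]; positivity

lemma hook_le_hook {x y : ℕ → ℝ} (hx : ∀ i, 0 ≤ x i) (hxy : ∀ i, x i ≤ y i) (N k j : ℕ) :
    hook x N k j ≤ hook y N k j := by
  have hy i := (hx i).trans (hxy i)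
  induction N generalizing k j with
  | zero => simp [hook]
  | succ N ihN =>
    induction k generalizing j with
    | zero => simp [hook]
    | succ k ihk =>
      cases j with
      | zero =>
        simp only [hook]
        gcongr <;> first
          | exact hook_nonneg hx _ _ _ | exact hxy _ | exact ihk _ | exact ihN _ _ | exact hy _
      | succ j =>
        simp only [hook]
        gcongr <;> first
          | exact hook_nonneg hx _ _ _ | exact hxy _ | exact ihk _ | exact ihN _ _ | exact hy _

lemma norm_hook_le (x : ℕ → ℂ) (N k j : ℕ) :
    ‖hook x N k j‖ ≤ hook (fun i => ‖x i‖) N k j := by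
  induction N generalizing k j with
  | zero => simp [hook]
  | succ N ihN =>
    induction k generalizing j with
    | zero => simp only [hook]; split_ifs <;> simp
    | succ k ihk =>
      cases j with
      | zero =>
        simp only [hook]
        refine (norm_add_le _ _).trans ?_
        simp only [norm_mul]
        gcongr
        exacts [ihk _, ihN _ _]
      | succ j =>
        simp only [hook]
        refine (norm_add₃_le).trans ?_
        simp only [norm_mul]
        gcongr
        exacts [ihk _, ihN _ _, ihN _ _]

lemma hook_const {R : Type*} [CommSemiring R] (r : R) (N k j : ℕ) (h : j ≤ N) :
    hook (fun _ => r) (N + 1) k j =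
      (N + k).choose j * (N + k - j - 1).choose (N - j) * r ^ (N + k - j) := by
  induction N generalizing k j with
  | zero =>
    obtain rfl : j = 0 := by omega
    induction k with
    | zero => simp [hook]
    | succ k ihk => simp [hook, ihk, pow_succ']
  | succ N ihN =>
    induction k generalizing j with
    | zero =>
      simp only [hook]
      split_ifs with hj
      · subst hj; simp
      · rw [Nat.choose_eq_zero_of_lt (show N + 1 + 0 - j - 1 < N + 1 - j by omega)]; simp
    | succ k ihk =>
      cases j with
      | zero =>
        rw [hook, ihk 0 (by omega), ihN (k + 1) 0 (by omega)]
        rw [show N + 1 + (k + 1) - 0 - 1 = N + k + 1 by omega,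
          show N + 1 + k - 0 - 1 = N + k by omega, show N + (k + 1) - 0 - 1 = N + k by omega,
          show N + 1 + (k + 1) - 0 = (N + k + 1) + 1 by omega,
          show N + 1 + k - 0 = N + k + 1 by omega, show N + (k + 1) - 0 = N + k + 1 by omega,
          show N + 1 - 0 = N + 1 by omega, show N - 0 = N by omega, Nat.choose_succ_succ]
        push_cast
        simp
        ring
      | succ j =>
        rcases Nat.lt_or_ge j N with hj | hj
        · obtain ⟨d, rfl⟩ : ∃ d, N = j + 1 + d := ⟨N - j - 1, by omega⟩
          rw [hook, ihk _ h, ihN (k + 1) j (by omega), ihN (k + 1) (j + 1) (by omega)]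
          rw [show j + 1 + d + 1 + (k + 1) - (j + 1) - 1 = d + k + 1 by omega,
            show j + 1 + d + 1 + k - (j + 1) - 1 = d + k by omega,
            show j + 1 + d + (k + 1) - j - 1 = d + k + 1 by omega,
            show j + 1 + d + (k + 1) - (j + 1) - 1 = d + k by omega,
            show j + 1 + d + 1 + (k + 1) - (j + 1) = d + k + 1 + 1 by omega,
            show j + 1 + d + 1 + k - (j + 1) = d + k + 1 by omega,
            show j + 1 + d + (k + 1) - j = d + k + 1 + 1 by omega,
            show j + 1 + d + (k + 1) - (j + 1) = d + k + 1 by omega,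
            show j + 1 + d + 1 - (j + 1) = d + 1 by omega,
            show j + 1 + d - j = d + 1 by omega, show j + 1 + d - (j + 1) = d by omega,
            show j + 1 + d + 1 + (k + 1) = (j + d + k + 2) + 1 by omega,
            show j + 1 + d + 1 + k = j + d + k + 2 by omega,
            show j + 1 + d + (k + 1) = j + d + k + 2 by omega,
            Nat.choose_succ_succ (j + d + k + 2), Nat.choose_succ_succ (d + k)]
          push_cast
          ring
        · obtain rfl : j = N := by omega
          rw [hook, ihk _ h, ihN (k + 1) j le_rfl, hook_eq_zero _ _ _ _ le_rfl]
          rw [show j + 1 + (k + 1) - (j + 1) = k + 1 by omega,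
            show j + 1 + k - (j + 1) = k by omega, show j + (k + 1) - j = k + 1 by omega,
            show j + 1 + (k + 1) = (j + k + 1) + 1 by omega,
            show j + 1 + k = j + k + 1 by omega, show j + (k + 1) = j + k + 1 by omega,
            Nat.choose_succ_succ (j + k + 1)]
          simp
          ring

lemma sum_hook_succ {R : Type*} [CommRing R] (x : ℕ → R) (N k : ℕ) (z : R) :
    ∑ j ∈ Finset.range (N + 1), (-1) ^ (N + 1 + j + 1) * hook x (N + 1) (k + 1) j * z ^ j =
      x N * ∑ j ∈ Finset.range (N + 1), (-1) ^ (N + 1 + j + 1) * hook x (N + 1) k j * z ^ j +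
      (z - x N) * ∑ j ∈ Finset.range N, (-1) ^ (N + j + 1) * hook x N (k + 1) j * z ^ j := by
  have h0 : ∑ j ∈ Finset.range N, (-1) ^ (N + j + 1) * hook x N (k + 1) j * z ^ j =
      ∑ j ∈ Finset.range (N + 1), (-1) ^ (N + j + 1) * hook x N (k + 1) j * z ^ j := by
    rw [Finset.sum_range_succ, hook_eq_zero x N _ _ le_rfl]; simp
  rw [sub_mul]
  nth_rewrite 2 [h0]
  rw [Finset.sum_range_succ', Finset.sum_range_succ' (n := N), Finset.sum_range_succ' (n := N)]
  simp only [hook, mul_add, Finset.mul_sum, Finset.sum_add_distrib, add_mul]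
  have e1 : ∀ j, (-1 : R) ^ (N + 1 + (j + 1) + 1) * hook x N (k + 1) j * z ^ (j + 1) =
    z * ((-1) ^ (N + j + 1) * hook x N (k + 1) j * z ^ j) := fun j => by ring
  have e2 : ∀ j, (-1 : R) ^ (N + 1 + (j + 1) + 1) * (x N * hook x N (k + 1) (j + 1)) * z ^ (j + 1) =
    -(x N * ((-1) ^ (N + (j + 1) + 1) * hook x N (k + 1) (j + 1) * z ^ (j + 1))) :=
      fun j => by ring
  simp only [e1, e2, Finset.sum_neg_distrib]
  have e3 : ∀ j, (-1 : R) ^ (N + 1 + (j + 1) + 1) * (x N * hook x (N + 1) k (j + 1)) * z ^ (j + 1) =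
    x N * ((-1 : R) ^ (N + 1 + (j + 1) + 1) * hook x (N + 1) k (j + 1) * z ^ (j + 1)) :=
      fun j => by ring
  simp only [e3]
  ring

lemma pow_eq_sum_hook {R : Type*} [CommRing R] (x : ℕ → R) (N k i : ℕ) (hi : i ≤ N) :
    x i ^ (N + k) =
      ∑ j ∈ Finset.range (N + 1), (-1) ^ (N + 1 + j + 1) * hook x (N + 1) k j * x i ^ j := by
  induction N generalizing k with
  | zero =>
    obtain rfl : i = 0 := by omega
    induction k with
    | zero => simp [hook]
    | succ k ihk => rw [sum_hook_succ, ← ihk]; simp; ring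
  | succ N ihN =>
    induction k with
    | zero =>
      rw [Finset.sum_range_succ, Finset.sum_eq_zero]
      · simp only [hook]; simp [show N + 1 + 1 + (N + 1) + 1 = 2 * (N + 2) by ring]
      · intro j hj
        have : j ≠ N + 1 := by simp at hj; omega
        simp [hook, this]
    | succ k ihk =>
      rw [sum_hook_succ, ← ihk]
      rcases hi.eq_or_lt with rfl | hi
      · ring
      · rw [← ihN (k + 1) (by omega)]; ring

lemma CC_pos {n : ℕ} {c : Fin (n + 1) → ℝ} (hc : ∀ j, 0 < c j) {M : ℕ} (hM : n + 1 ≤ M)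
    {ρ : ℝ} (hρ : 0 < ρ) : 0 < CC (n + 1) c M ρ := by
  refine Finset.sum_pos (fun j _ => ?_) Finset.univ_nonempty
  have h1 := hc j
  have h2 : 0 < M.choose j := Nat.choose_pos (by omega)
  have h3 : 0 < (M - (j : ℕ) - 1).choose (n + 1 - (j : ℕ) - 1) := Nat.choose_pos (by omega)
  positivity

lemma sum_mul_pow_eq_hook {R : Type*} [CommRing R] {n : ℕ} (x : Fin (n + 1) → R) (k : ℕ)
    (w : Fin (n + 1) → R) :
    ∑ i, w i * x i ^ (n + k) = ∑ j : Fin (n + 1),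
      ((-1) ^ (n + 1 + (j : ℕ) + 1) * hook (fun m => x (Fin.ofNat (n + 1) m)) (n + 1) k j) *
        ∑ i, w i * x i ^ (j : ℕ) := by
  simp only [Finset.mul_sum]
  rw [Finset.sum_comm]
  refine Finset.sum_congr rfl fun i _ => ?_
  have h := pow_eq_sum_hook (fun m => x (Fin.ofNat (n + 1) m)) n k i (by omega)
  have hi : Fin.ofNat (n + 1) (i : ℕ) = i := by simp
  simp only [hi] at h
  rw [h, Finset.sum_range, Finset.mul_sum]
  exact Finset.sum_congr rfl fun j _ => by ring

lemma hook_const_sqrt_sq {n : ℕ} (k : ℕ) (j : Fin (n + 1)) {ρ : ℝ} (hρ : 0 ≤ ρ) :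
    hook (fun _ => √ρ) (n + 1) k j ^ 2 = ((n + k).choose j : ℝ) ^ 2 *
      ((n + k - (j : ℕ) - 1).choose (n + 1 - (j : ℕ) - 1) : ℝ) ^ 2 * ρ ^ (n + k - (j : ℕ)) := by
  rw [hook_const _ _ _ _ (by omega), mul_pow, mul_pow, ← pow_mul, mul_comm _ 2, pow_mul,
    Real.sq_sqrt hρ, show n + 1 - (j : ℕ) - 1 = n - j by omega]

lemma norm_sum_mul_pow_sq_le {n : ℕ} {c : Fin (n + 1) → ℝ} (hc : ∀ j, 0 < c j) (k : ℕ)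
    {ρ : ℝ} (hρ : 0 ≤ ρ) {x : Fin (n + 1) → ℂ} (hx : ∀ i, ‖x i‖ ^ 2 ≤ ρ) (w : Fin (n + 1) → ℂ) :
    ‖∑ i, w i * x i ^ (n + k)‖ ^ 2 ≤
      CC (n + 1) c (n + k) ρ * ∑ j, c j * ‖∑ i, w i * x i ^ (j : ℕ)‖ ^ 2 := by
  rw [sum_mul_pow_eq_hook]
  set a : Fin (n + 1) → ℂ := fun j =>
    (-1) ^ (n + 1 + (j : ℕ) + 1) * hook (fun m => x (Fin.ofNat (n + 1) m)) (n + 1) k j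
  have ha : ∀ j, ‖a j‖ ≤ hook (fun _ => √ρ) (n + 1) k j := fun j => by
    simp only [a, norm_mul, norm_pow, norm_neg, norm_one, one_pow, one_mul]
    exact (norm_hook_le _ _ _ _).trans (hook_le_hook (fun _ => norm_nonneg _)
      (fun _ => Real.le_sqrt_of_sq_le (hx _)) _ _ _)
  calc ‖∑ j, a j * ∑ i, w i * x i ^ (j : ℕ)‖ ^ 2
      ≤ (∑ j, ‖a j‖ * ‖∑ i, w i * x i ^ (j : ℕ)‖) ^ 2 := by
        gcongr
        exact (norm_sum_le _ _).trans_eq (by simp only [norm_mul])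
    _ ≤ (∑ j, ‖a j‖ ^ 2 / c j) * ∑ j, c j * ‖∑ i, w i * x i ^ (j : ℕ)‖ ^ 2 := by
        refine Finset.sum_sq_le_sum_mul_sum_of_sq_le_mul _ (fun j _ => ?_) (fun j _ => ?_)
          (fun j _ => ?_)
        · have := hc j; positivity
        · have := hc j; positivity
        · have := (hc j).ne'; exact (by field_simp : _ = _).le
    _ ≤ _ := by
        gcongr with j
        · exact Finset.sum_nonneg fun j _ => by have := hc j; positivity
        · refine Finset.sum_le_sum fun j _ => ?_
          rw [← hook_const_sqrt_sq k j hρ]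
          have := hc j
          gcongr
          exact ha j

lemma star_dotProduct_hadPow_mulVec {N : ℕ} (x : Fin N → ℂ) (k : ℕ) (v : Fin N → ℂ) :
    star v ⬝ᵥ hadPow (Matrix.vecMulVec x (star x)) k *ᵥ v =
      ((‖∑ i, star v i * x i ^ k‖ ^ 2 : ℝ) : ℂ) := by
  rw [Complex.ofReal_pow, ← Complex.mul_conj', map_sum, Finset.sum_mul_sum]
  simp only [dotProduct, Matrix.mulVec, hadPow, Matrix.of_apply, Matrix.vecMulVec_apply,
    Finset.mul_sum]
  refine Finset.sum_congr rfl fun i _ => Finset.sum_congr rfl fun j _ => ?_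
  simp [mul_pow]
  ring

lemma star_dotProduct_sum_hadPow_mulVec {N : ℕ} (c : Fin N → ℝ) (A : Matrix (Fin N) (Fin N) ℂ)
    (v : Fin N → ℂ) :
    star v ⬝ᵥ (∑ j : Fin N, (c j : ℂ) • hadPow A (j : ℕ)) *ᵥ v =
      ∑ j : Fin N, (c j : ℂ) * (star v ⬝ᵥ hadPow A (j : ℕ) *ᵥ v) := by
  simp [Matrix.sum_mulVec, dotProduct_sum, Matrix.smul_mulVec]

open Polynomial in
lemma isHermitian_map_aeval {N : ℕ} {A : Matrix (Fin N) (Fin N) ℂ} (hA : A.IsHermitian)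
    (p : ℝ[X]) : (A.map (aeval · p)).IsHermitian := by
  ext i j
  have h : star (A j i) = A i j := hA.apply i j
  have := aeval_conj p (A j i)
  simp only [Matrix.conjTranspose_apply, Matrix.map_apply]
  rw [← h]
  exact this.symm

lemma posSemidef_of_re_nonneg {N : ℕ} {A : Matrix (Fin N) (Fin N) ℂ} (hA : A.IsHermitian)
    (h : ∀ v, 0 ≤ (star v ⬝ᵥ A *ᵥ v).re) : A.PosSemidef :=
  .of_dotProduct_mulVec_nonneg hA fun v =>
    Complex.nonneg_iff.2 ⟨h v, (hA.im_star_dotProduct_mulVec_self v).symm⟩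

/-- The Schur complement decomposition of a positive semidefinite matrix. -/
lemma exists_eq_vecMulVec_add {N : ℕ} {A : Matrix (Fin (N + 1)) (Fin (N + 1)) ℂ}
    (hA : A.PosSemidef) : ∃ (x : Fin (N + 1) → ℂ) (B : Matrix (Fin (N + 1)) (Fin (N + 1)) ℂ),
      A = Matrix.vecMulVec x (star x) + B ∧ B.PosSemidef ∧ (∀ i, B i 0 = 0) ∧ ∀ i, B 0 i = 0 := by
  have hs i j : star (A i j) = A j i := hA.1.apply j i
  obtain ⟨a, ha0, ha⟩ : ∃ a : ℝ, 0 ≤ a ∧ A 0 0 = a := by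
    have h := Complex.nonneg_iff.1 (hA.diag_nonneg (i := 0))
    exact ⟨(A 0 0).re, h.1, Complex.ext rfl h.2.symm⟩
  rcases ha0.eq_or_lt with rfl | ha0
  · have hcol i : A i 0 = 0 := by
      have h := (hA.submatrix ![i, 0]).det_nonneg
      rw [Matrix.det_fin_two] at h
      simp only [Matrix.submatrix_apply, Matrix.cons_val_zero, Matrix.cons_val_one, ha] at h
      rw [← hs i 0] at h
      have h' := (Complex.nonneg_iff.1 h).1
      simp [Complex.mul_conj] at h'
      have := Complex.normSq_nonneg (A i 0)
      exact Complex.normSq_eq_zero.1 (by linarith)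
    exact ⟨0, A, by simp, hA, hcol, fun i => by rw [← hs, hcol, star_zero]⟩
  · have ha' : (a : ℂ) ≠ 0 := by exact_mod_cast ha0.ne'
    have hsq : ((√a : ℝ) : ℂ) * (√a : ℝ) = a := by
      rw [← Complex.ofReal_mul, Real.mul_self_sqrt ha0.le]
    have hsq0 : ((√a : ℝ) : ℂ) ≠ 0 := by exact_mod_cast (Real.sqrt_pos.2 ha0).ne'
    let x : Fin (N + 1) → ℂ := fun i => A i 0 / (√a : ℝ)
    let B := A - Matrix.vecMulVec x (star x)
    have hB i j : B i j = A i j - A i 0 * A 0 j / a := by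
      simp only [B, x, Matrix.sub_apply, Matrix.vecMulVec_apply, Pi.star_apply, star_div₀, hs]
      rw [← hsq]
      simp only [Complex.star_def, Complex.conj_ofReal]
      field_simp
    have hr i : B 0 i = 0 := by rw [hB, ha]; field_simp; simp
    have hc i : B i 0 = 0 := by rw [hB, ha]; field_simp; simp
    refine ⟨x, B, by simp [B], ?_, hc, hr⟩
    let E : Matrix (Fin (N + 1)) (Fin (N + 1)) ℂ :=
      Matrix.of fun i j => if i = 0 then A 0 j / a else 0
    have hAC : A * (1 - E) = B := by
      ext i j
      rw [hB, Matrix.mul_sub, Matrix.mul_one, Matrix.sub_apply, Matrix.mul_apply]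
      simp [E, mul_div_assoc]
    have hCB : (1 - E)ᴴ * B = B := by
      ext i j
      rw [Matrix.conjTranspose_sub, Matrix.conjTranspose_one, Matrix.sub_mul, Matrix.one_mul,
        Matrix.sub_apply, Matrix.mul_apply]
      simp [E, Matrix.conjTranspose_apply, apply_ite, hr]
    rw [← hCB, ← hAC, ← Matrix.mul_assoc]
    exact hA.conjTranspose_mul_mul_same (1 - E)

open Polynomial in
lemma hasDerivAt_re_dotProduct_map_aeval {N : ℕ} (p : ℝ[X]) (Z B : Matrix (Fin N) (Fin N) ℂ)
    (v : Fin N → ℂ) (t : ℝ) :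
    HasDerivAt (fun t : ℝ => (star v ⬝ᵥ ((Z + (t : ℂ) • B).map (aeval · p)) *ᵥ v).re)
      (star v ⬝ᵥ (B ⊙ (Z + (t : ℂ) • B).map (aeval · (derivative p))) *ᵥ v).re t := by
  have hentry (i j : Fin N) : HasDerivAt (fun t : ℝ => aeval (Z i j + (t : ℂ) * B i j) p)
      (B i j * aeval (Z i j + (t : ℂ) * B i j) (derivative p)) t := by
    have h1 : HasDerivAt (fun s : ℂ => Z i j + s * B i j) (B i j) (t : ℂ) := by
      simpa using ((hasDerivAt_id (t : ℂ)).mul_const (B i j)).const_add (Z i j)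
    have h2 := ((p.hasDerivAt_aeval (Z i j + (t : ℂ) * B i j)).comp (t : ℂ) h1).comp_ofReal
    rw [mul_comm]
    exact h2
  refine Complex.reCLM.hasFDerivAt.comp_hasDerivAt t ?_
  simp only [dotProduct, Matrix.mulVec, Matrix.map_apply, Matrix.hadamard_apply, Matrix.add_apply,
    Matrix.smul_apply, smul_eq_mul]
  exact HasDerivAt.fun_sum fun i _ => (HasDerivAt.fun_sum fun j _ =>
    (hentry i j).mul_const (v j)).const_mul (star v i)

open Polynomial in
/-- An extension principle: entrywise positivity of `p` in dimension `N + 1` follows from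
positivity on rank-one matrices and positivity of the derivative of `p` in dimension `N`. -/
lemma posSemidef_map_aeval_succ {N : ℕ} {ρ : ℝ} (p : ℝ[X])
    (h_rank_one : ∀ x : Fin (N + 1) → ℂ, (∀ i, ‖x i‖ ^ 2 ≤ ρ) →
      ((Matrix.vecMulVec x (star x)).map (aeval · p)).PosSemidef)
    (h_deriv : ∀ A : Matrix (Fin N) (Fin N) ℂ, A.PosSemidef → (∀ i, (A i i).re ≤ ρ) →
      (A.map (aeval · (derivative p))).PosSemidef)
    {A : Matrix (Fin (N + 1)) (Fin (N + 1)) ℂ} (hA : A.PosSemidef) (hd : ∀ i, (A i i).re ≤ ρ) :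
    (A.map (aeval · p)).PosSemidef := by
  obtain ⟨x, B, rfl, hB, hc, hr⟩ := exists_eq_vecMulVec_add hA
  set Z := Matrix.vecMulVec x (star x)
  have hZ : Z.PosSemidef := Matrix.posSemidef_vecMulVec_self_star x
  have hZd i : (Z i i).re = ‖x i‖ ^ 2 := by
    simp only [Z, Matrix.vecMulVec_apply, Pi.star_apply, Complex.star_def, Complex.mul_conj']
    exact_mod_cast rfl
  have hBd i : 0 ≤ (B i i).re := (Complex.nonneg_iff.1 (hB.diag_nonneg (i := i))).1
  have hx i : ‖x i‖ ^ 2 ≤ ρ := by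
    have := hd i
    rw [Matrix.add_apply, Complex.add_re, hZd] at this
    linarith [hBd i]
  refine posSemidef_of_re_nonneg (isHermitian_map_aeval hA.1 p) fun v => ?_
  let φ : ℝ → ℝ := fun t => (star v ⬝ᵥ ((Z + (t : ℂ) • B).map (aeval · p)) *ᵥ v).re
  have hφ t := hasDerivAt_re_dotProduct_map_aeval p Z B v t
  have hmono : MonotoneOn φ (Set.Icc 0 1) := by
    refine monotoneOn_of_deriv_nonneg (convex_Icc 0 1)
      (fun t _ => (hφ t).continuousAt.continuousWithinAt)
      (fun t _ => (hφ t).differentiableAt.differentiableWithinAt) fun t ht => ?_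
    rw [interior_Icc] at ht
    rw [(hφ t).deriv]
    have hAt : (Z + (t : ℂ) • B).PosSemidef :=
      hZ.add (hB.smul (Complex.zero_le_real.2 ht.1.le))
    have hD := (hB.submatrix Fin.succ).hadamard
      (h_deriv ((Z + (t : ℂ) • B).submatrix Fin.succ Fin.succ) (hAt.submatrix _) fun i => ?_)
    · have h := (Complex.nonneg_iff.1 (hD.dotProduct_mulVec_nonneg fun i => v i.succ)).1
      convert h using 2
      simp [dotProduct, Matrix.mulVec, Fin.sum_univ_succ, hc, hr]
    · have h := hd i.succ
      rw [Matrix.add_apply, Complex.add_re] at h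
      simp only [Matrix.submatrix_apply, Matrix.add_apply, Matrix.smul_apply, smul_eq_mul,
        Complex.add_re, Complex.re_ofReal_mul]
      nlinarith [hBd i.succ, ht.2]
  have h0 : 0 ≤ φ 0 := by
    have := (Complex.nonneg_iff.1 ((h_rank_one x hx).dotProduct_mulVec_nonneg v)).1
    simpa [φ] using this
  have h1 := hmono (Set.left_mem_Icc.2 zero_le_one) (Set.right_mem_Icc.2 zero_le_one) zero_le_one
  simpa [φ] using h0.trans h1

lemma posSemidef_hadPow {N : ℕ} {A : Matrix (Fin N) (Fin N) ℂ} (hA : A.PosSemidef) (k : ℕ) :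
    (hadPow A k).PosSemidef := by
  induction k with
  | zero =>
    convert Matrix.posSemidef_vecMulVec_self_star (1 : Fin N → ℂ)
    ext
    simp [hadPow, Matrix.vecMulVec_apply]
  | succ k ih =>
    have h : hadPow A (k + 1) = hadPow A k ⊙ A := by
      ext
      simp [hadPow, pow_succ]
    rw [h]
    exact ih.hadamard hA

lemma posSemidef_sum_hadPow {N : ℕ} {c : Fin N → ℝ} (hc : ∀ j, 0 < c j)
    {n : ℕ} {A : Matrix (Fin n) (Fin n) ℂ} (hA : A.PosSemidef) :
    (∑ j : Fin N, (c j : ℂ) • hadPow A (j : ℕ)).PosSemidef :=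
  Matrix.posSemidef_sum _ fun j _ =>
    (posSemidef_hadPow hA j).smul (Complex.zero_le_real.2 (hc j).le)

lemma succ_mul_CC_le {N M : ℕ} (hM : N ≤ M) {c : Fin (N + 1) → ℝ} (hc : ∀ j, 0 < c j)
    {ρ : ℝ} (hρ : 0 ≤ ρ) :
    (M + 1) * CC N (fun j => (j + 1) * c j.succ) M ρ ≤ CC (N + 1) c (M + 1) ρ := by
  rw [CC, CC, Fin.sum_univ_succ, Finset.mul_sum]
  refine (Finset.sum_le_sum fun j _ => ?_).trans (le_add_of_nonneg_left ?_)
  · have h1 := hc j.succ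
    rw [Fin.val_succ, Nat.add_sub_add_right, Nat.add_sub_add_right]
    have h2 : ((M + 1 : ℕ) : ℝ) * M.choose j = (M + 1).choose (j + 1) * ((j : ℕ) + 1 : ℕ) := by
      exact_mod_cast Nat.add_one_mul_choose_eq M j
    push_cast at h2
    have h3 : ((j : ℕ) + 1 : ℝ) ≤ M + 1 := by
      have := j.2
      exact_mod_cast (by omega : (j : ℕ) + 1 ≤ M + 1)
    have h4 : (0 : ℝ) < M + 1 := by positivity
    have h5 : (M.choose j : ℝ) = (M + 1).choose (j + 1) * ((j : ℕ) + 1) / (M + 1) := by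
      rw [← h2]; field_simp
    rw [h5]
    calc _ = ((j : ℕ) + 1 : ℝ) / (M + 1) * (((M + 1).choose (j + 1) : ℝ) ^ 2 *
          ((M - (j : ℕ) - 1).choose (N - (j : ℕ) - 1) : ℝ) ^ 2 * ρ ^ (M - (j : ℕ)) / c j.succ) := by
          field_simp
      _ ≤ _ := mul_le_of_le_one_left (by positivity) ((div_le_one h4).2 h3)
  · have := hc 0
    positivity

open Polynomial in
lemma map_aeval_sub_X_pow {N n : ℕ} (c : Fin N → ℝ) (κ : ℝ) (M : ℕ)
    (A : Matrix (Fin n) (Fin n) ℂ) :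
    A.map (aeval · (C κ * ∑ j : Fin N, C (c j) * X ^ (j : ℕ) - X ^ M)) =
      (κ : ℂ) • (∑ j : Fin N, (c j : ℂ) • hadPow A (j : ℕ)) - hadPow A M := by
  ext i j
  simp [hadPow, Matrix.sum_apply]

open Polynomial in
lemma posSemidef_CC_smul_sub_hadPow {N M : ℕ} (hM : N ≤ M) {c : Fin N → ℝ} (hc : ∀ j, 0 < c j)
    {ρ : ℝ} (hρ : 0 ≤ ρ) {A : Matrix (Fin N) (Fin N) ℂ} (hA : A.PosSemidef)
    (hd : ∀ i, (A i i).re ≤ ρ) :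
    ((CC N c M ρ : ℂ) • (∑ j : Fin N, (c j : ℂ) • hadPow A (j : ℕ)) - hadPow A M).PosSemidef := by
  induction N generalizing M with
  | zero =>
    convert Matrix.PosSemidef.zero
    ext i
    exact i.elim0
  | succ N ih =>
    obtain ⟨M, rfl⟩ : ∃ m, M = m + 1 := ⟨M - 1, by omega⟩
    have hM' : N ≤ M := by omega
    rw [← map_aeval_sub_X_pow]
    refine posSemidef_map_aeval_succ _ (fun x hx => ?_) (fun A hA hd => ?_) hA hd
    · have hH := isHermitian_map_aeval (Matrix.posSemidef_vecMulVec_self_star x).1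
        (C (CC (N + 1) c (M + 1) ρ) * ∑ j : Fin (N + 1), C (c j) * X ^ (j : ℕ) - X ^ (M + 1))
      refine posSemidef_of_re_nonneg hH fun v => ?_
      obtain ⟨k, hk⟩ : ∃ k, M + 1 = N + k := ⟨M + 1 - N, by omega⟩
      have h := norm_sum_mul_pow_sq_le hc k hρ hx (star v)
      rw [map_aeval_sub_X_pow, Matrix.sub_mulVec, Matrix.smul_mulVec, dotProduct_sub,
        dotProduct_smul, star_dotProduct_sum_hadPow_mulVec]
      simp only [star_dotProduct_hadPow_mulVec, smul_eq_mul, ← Complex.ofReal_mul,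
        ← Complex.ofReal_sum, ← Complex.ofReal_sub, Complex.ofReal_re]
      rw [hk]
      linarith
    · let c' : Fin N → ℝ := fun j => (j + 1) * c j.succ
      have hc' j : 0 < c' j := mul_pos (by positivity) (hc _)
      have h : A.map (aeval · (derivative
          (C (CC (N + 1) c (M + 1) ρ) * ∑ j : Fin (N + 1), C (c j) * X ^ (j : ℕ) -
            X ^ (M + 1)))) =
          ((M + 1 : ℝ) : ℂ) • ((CC N c' M ρ : ℂ) •
            (∑ j : Fin N, (c' j : ℂ) • hadPow A (j : ℕ)) - hadPow A M) +
          ((CC (N + 1) c (M + 1) ρ - (M + 1) * CC N c' M ρ : ℝ) : ℂ) •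
            ∑ j : Fin N, (c' j : ℂ) • hadPow A (j : ℕ) := by
        have hS i j : (∑ j : Fin N, (c' j : ℂ) • hadPow A (j : ℕ)) i j =
            ∑ l : Fin N, (c l.succ : ℂ) * (((l : ℕ) + 1) * A i j ^ (l : ℕ)) := by
          simp only [Matrix.sum_apply, c', hadPow, Matrix.smul_apply, Matrix.of_apply, smul_eq_mul]
          exact Finset.sum_congr rfl fun l _ => by push_cast; ring
        ext i j
        rw [Matrix.add_apply, Matrix.smul_apply, Matrix.smul_apply, Matrix.sub_apply,
          Matrix.smul_apply, hS]
        simp [hadPow, Fin.sum_univ_succ]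
        ring
      rw [h]
      exact ((ih hM' hc' hA hd).smul
        (Complex.zero_le_real.2 (by positivity : (0 : ℝ) ≤ M + 1))).add
        ((posSemidef_sum_hadPow hc' hA).smul
          (Complex.zero_le_real.2 (sub_nonneg.2 (succ_mul_CC_le hM' hc hρ))))

lemma exists_sum_mul_pow_eq {n : ℕ} {x : Fin n → ℝ} (hx : Function.Injective x) (y : Fin n → ℝ) :
    ∃ u : Fin n → ℝ, ∀ j : Fin n, ∑ i, u i * x i ^ (j : ℕ) = y j := by
  have hdet : IsUnit (Matrix.vandermonde x).det := (Matrix.det_vandermonde_ne_zero_iff.2 hx).isUnit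
  refine ⟨y ᵥ* (Matrix.vandermonde x)⁻¹, fun j => ?_⟩
  have h : (y ᵥ* (Matrix.vandermonde x)⁻¹) ᵥ* Matrix.vandermonde x = y := by
    rw [Matrix.vecMul_vecMul, Matrix.nonsing_inv_mul _ hdet, Matrix.vecMul_one]
  exact congrFun h j

lemma eq_zero_of_sum_hadPow_mulVec_eq_zero {N : ℕ} {c : Fin N → ℝ}
    (hc : ∀ j, 0 < c j) {x : Fin N → ℂ} (hx : Function.Injective x) {w : Fin N → ℂ}
    (hw : (∑ j : Fin N, (c j : ℂ) • hadPow (Matrix.vecMulVec x (star x)) (j : ℕ)) *ᵥ w = 0) :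
    w = 0 := by
  have h : star w ⬝ᵥ (∑ j : Fin N, (c j : ℂ) •
      hadPow (Matrix.vecMulVec x (star x)) (j : ℕ)) *ᵥ w = 0 := by rw [hw, dotProduct_zero]
  rw [star_dotProduct_sum_hadPow_mulVec] at h
  simp only [star_dotProduct_hadPow_mulVec, ← Complex.ofReal_mul, ← Complex.ofReal_sum,
    Complex.ofReal_eq_zero] at h
  rw [Finset.sum_eq_zero_iff_of_nonneg fun j _ => by have := hc j; positivity] at h
  refine star_eq_zero.1 (Matrix.eq_zero_of_forall_pow_sum_mul_pow_eq_zero hx fun j => ?_)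
  have := h j (Finset.mem_univ j)
  simpa [(hc j).ne'] using this

/-- Some rank-one matrix with entries in `(0, ρ)` has quotient at most `CC⁻¹` at radius `σ < ρ`. -/
lemma exists_rank_one_quotient_le {n k : ℕ} (hk : 1 ≤ k) {c : Fin (n + 1) → ℝ}
    (hc : ∀ j, 0 < c j) {σ ρ : ℝ} (hσ : 0 < σ) (hσρ : σ < ρ) :
    ∃ (A : Matrix (Fin (n + 1)) (Fin (n + 1)) ℂ) (v : Fin (n + 1) → ℂ),
      A.PosSemidef ∧ A ≠ 0 ∧ A.rank ≤ 1 ∧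
      (∀ i j, ∃ x : ℝ, x ∈ Set.Ioo (0 : ℝ) ρ ∧ A i j = (x : ℂ)) ∧
      (∀ w : Fin (n + 1) → ℂ, (∑ j : Fin (n + 1), (c j : ℂ) • hadPow A (j : ℕ)) *ᵥ w = 0 →
        star v ⬝ᵥ w = 0) ∧
      star v ⬝ᵥ hadPow A (n + k) *ᵥ v ≠ 0 ∧
      (star v ⬝ᵥ (∑ j : Fin (n + 1), (c j : ℂ) • hadPow A (j : ℕ)) *ᵥ v).re
        / (star v ⬝ᵥ hadPow A (n + k) *ᵥ v).re ≤ (CC (n + 1) c (n + k) σ)⁻¹ := by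
  have hs : 0 < √σ := Real.sqrt_pos.2 hσ
  have hsr : √σ < √ρ := Real.sqrt_lt_sqrt hσ.le hσρ
  let x : Fin (n + 1) → ℝ := fun i => √σ + (√ρ - √σ) * (((i : ℕ) + 1) / (n + 2))
  have hxs i : √σ ≤ x i := by
    have := sub_pos.2 hsr
    exact le_add_of_nonneg_right (by positivity)
  have hx0 i : 0 < x i := hs.trans_le (hxs i)
  have hxr i : x i < √ρ := by
    have h1 : (((i : ℕ) + 1) / (n + 2) : ℝ) < 1 := by
      rw [div_lt_one (by positivity)]
      exact_mod_cast (by omega : (i : ℕ) + 1 < n + 2)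
    have := mul_lt_mul_of_pos_left h1 (sub_pos.2 hsr)
    simp only [x]
    linarith
  have hinj : Function.Injective x := fun i j hij => by
    have h2 : (n + 2 : ℝ) ≠ 0 := by positivity
    have h3 := (sub_pos.2 hsr).ne'
    simp only [x, add_right_inj, mul_right_inj' h3, div_left_inj' h2, add_left_inj,
      Nat.cast_inj] at hij
    exact Fin.ext hij
  let a : Fin (n + 1) → ℝ := fun j =>
    (-1) ^ (n + 1 + (j : ℕ) + 1) * hook (fun m => x (Fin.ofNat (n + 1) m)) (n + 1) k j
  obtain ⟨u, hu⟩ := exists_sum_mul_pow_eq hinj fun j => a j / c j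
  let T : ℝ := ∑ j, a j ^ 2 / c j
  have hT : CC (n + 1) c (n + k) σ ≤ T := by
    refine Finset.sum_le_sum fun j _ => ?_
    rw [← hook_const_sqrt_sq k j hσ.le]
    have := hc j
    have ha : a j ^ 2 = hook (fun m => x (Fin.ofNat (n + 1) m)) (n + 1) k j ^ 2 := by
      simp [a, mul_pow, ← pow_mul, mul_comm _ 2]
    rw [ha]
    gcongr
    · exact hook_nonneg (fun _ => hs.le) _ _ _
    · exact hook_le_hook (fun _ => hs.le) (fun _ => hxs _) _ _ _
  have hCC : 0 < CC (n + 1) c (n + k) σ := CC_pos hc (by omega) hσ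
  have hT0 : 0 < T := hCC.trans_le hT
  have hM : ∑ i, u i * x i ^ (n + k) = T := by
    rw [sum_mul_pow_eq_hook]
    exact Finset.sum_congr rfl fun j _ => by rw [hu]; ring
  let xc : Fin (n + 1) → ℂ := fun i => x i
  let v : Fin (n + 1) → ℂ := fun i => u i
  have hnorm m : ‖∑ i, star v i * xc i ^ m‖ ^ 2 = (∑ i, u i * x i ^ m) ^ 2 := by
    have : ∑ i, star v i * xc i ^ m = ((∑ i, u i * x i ^ m : ℝ) : ℂ) := by simp [v, xc]
    rw [this, Complex.norm_real, Real.norm_eq_abs, sq_abs]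
  have hden : star v ⬝ᵥ hadPow (Matrix.vecMulVec xc (star xc)) (n + k) *ᵥ v =
      ((T ^ 2 : ℝ) : ℂ) := by
    rw [star_dotProduct_hadPow_mulVec, hnorm, hM]
  have hnum : star v ⬝ᵥ (∑ j : Fin (n + 1), (c j : ℂ) •
      hadPow (Matrix.vecMulVec xc (star xc)) (j : ℕ)) *ᵥ v = (T : ℂ) := by
    rw [star_dotProduct_sum_hadPow_mulVec]
    simp only [star_dotProduct_hadPow_mulVec, hnorm, hu, T]
    rw [Complex.ofReal_sum]
    refine Finset.sum_congr rfl fun j _ => ?_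
    rw [← Complex.ofReal_mul]
    have := (hc j).ne'
    congr 1
    field_simp
  have hentry i j : Matrix.vecMulVec xc (star xc) i j = ((x i * x j : ℝ) : ℂ) := by
    simp [Matrix.vecMulVec_apply, xc]
  refine ⟨Matrix.vecMulVec xc (star xc), v, Matrix.posSemidef_vecMulVec_self_star xc,
    fun h => ?_, Matrix.rank_vecMulVec_le _ _, fun i j => ⟨x i * x j, ⟨?_, ?_⟩, hentry i j⟩,
    fun w hw => ?_, ?_, ?_⟩
  · have := hentry 0 0
    rw [h, Matrix.zero_apply, eq_comm, Complex.ofReal_eq_zero] at this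
    exact (mul_pos (hx0 0) (hx0 0)).ne' this
  · exact mul_pos (hx0 i) (hx0 j)
  · calc x i * x j < √ρ * √ρ := mul_lt_mul'' (hxr i) (hxr j) (hx0 i).le (hx0 j).le
      _ = ρ := Real.mul_self_sqrt (hσ.trans hσρ).le
  · rw [eq_zero_of_sum_hadPow_mulVec_eq_zero hc
      (Complex.ofReal_injective.comp hinj) hw, dotProduct_zero]
  · rw [hden]
    exact_mod_cast (by positivity : T ^ 2 ≠ 0)
  · rw [hden, hnum, Complex.ofReal_re, Complex.ofReal_re]
    calc T / T ^ 2 = T⁻¹ := by field_simp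
      _ ≤ _ := inv_anti₀ hCC hT

theorem stmt_6 (ρ : ℝ) (hρ : 0 < ρ) (N M : ℕ) (hN : 1 ≤ N) (hM : N ≤ M)
    (c : Fin N → ℝ) (hc : ∀ j, 0 < c j) :
    (∀ A : Matrix (Fin N) (Fin N) ℂ, A.PosSemidef → A ≠ 0 →
      (∀ i j, A i j ∈ Metric.closedBall (0 : ℂ) ρ) →
      ∀ v : Fin N → ℂ,
        (∀ w : Fin N → ℂ, (∑ j : Fin N, (c j : ℂ) • hadPow A (j : ℕ)) *ᵥ w = 0 →
          star v ⬝ᵥ w = 0) →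
        star v ⬝ᵥ hadPow A M *ᵥ v ≠ 0 →
        (CC N c M ρ)⁻¹ ≤
          (star v ⬝ᵥ (∑ j : Fin N, (c j : ℂ) • hadPow A (j : ℕ)) *ᵥ v).re
            / (star v ⬝ᵥ hadPow A M *ᵥ v).re)
    ∧ IsGLB { r : ℝ | ∃ A : Matrix (Fin N) (Fin N) ℂ, ∃ v : Fin N → ℂ,
        A.PosSemidef ∧ A ≠ 0 ∧ A.rank ≤ 1 ∧
        (∀ i j, ∃ x : ℝ, x ∈ Set.Ioo (0 : ℝ) ρ ∧ A i j = (x : ℂ)) ∧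
        (∀ w : Fin N → ℂ, (∑ j : Fin N, (c j : ℂ) • hadPow A (j : ℕ)) *ᵥ w = 0 →
          star v ⬝ᵥ w = 0) ∧
        star v ⬝ᵥ hadPow A M *ᵥ v ≠ 0 ∧
        r = (star v ⬝ᵥ (∑ j : Fin N, (c j : ℂ) • hadPow A (j : ℕ)) *ᵥ v).re
            / (star v ⬝ᵥ hadPow A M *ᵥ v).re }
      ((CC N c M ρ)⁻¹) := by
  have hCC : 0 < CC N c M ρ := by
    obtain ⟨n, rfl⟩ : ∃ n, N = n + 1 := ⟨N - 1, by omega⟩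
    exact CC_pos hc hM hρ
  refine (and_iff_left_of_imp fun h => ?_).2 ?_
  · refine ⟨?_, fun b hb => ?_⟩
    · rintro r ⟨A, v, hA, hA0, -, hent, hker, hne, rfl⟩
      refine h A hA hA0 (fun i j => ?_) v hker hne
      obtain ⟨x, hx, hx'⟩ := hent i j
      rw [hx', mem_closedBall_zero_iff, Complex.norm_real, Real.norm_eq_abs, abs_of_pos hx.1]
      exact hx.2.le
    · obtain ⟨n, rfl⟩ : ∃ n, N = n + 1 := ⟨N - 1, by omega⟩
      obtain ⟨k, rfl⟩ : ∃ k, M = n + k := ⟨M - n, by omega⟩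
      have hcont : Continuous (CC (n + 1) c (n + k)) := by
        unfold CC
        fun_prop
      have hlim := ((hcont.tendsto ρ).inv₀ hCC.ne').mono_left
        (nhdsWithin_le_nhds (s := Set.Iio ρ))
      refine ge_of_tendsto hlim ?_
      filter_upwards [Ioo_mem_nhdsLT hρ] with σ hσ
      obtain ⟨A, v, hA, hA0, hrk, hent, hker, hne, hle⟩ :=
        exists_rank_one_quotient_le (by omega : 1 ≤ k) hc hσ.1 hσ.2
      exact (hb ⟨A, v, hA, hA0, hrk, hent, hker, hne, rfl⟩).trans hle
  · intro A hA _ hent v _ hne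
    have hpos := posSemidef_CC_smul_sub_hadPow hM hc hρ.le hA fun i =>
      (Complex.re_le_norm _).trans (mem_closedBall_zero_iff.1 (hent i i))
    have h1 := (Complex.nonneg_iff.1 (hpos.dotProduct_mulVec_nonneg v)).1
    have h2 := Complex.nonneg_iff.1 ((posSemidef_hadPow hA M).dotProduct_mulVec_nonneg v)
    have h3 : 0 < (star v ⬝ᵥ hadPow A M *ᵥ v).re :=
      h2.1.lt_of_ne fun h0 => hne (Complex.ext h0.symm h2.2.symm)
    rw [Matrix.sub_mulVec, Matrix.smul_mulVec, dotProduct_sub, dotProduct_smul, smul_eq_mul,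
      Complex.sub_re, Complex.re_ofReal_mul] at h1
    rw [le_div_iff₀ h3, inv_mul_le_iff₀ hCC]
    linarith
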